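/- arXiv:1803.05016 — 8 statements merged into one kernel-verified Lean document; each statement's English description precedes it below -/
import Mathlib

section
/- Let ν, υ > 0 be real numbers, let a ≤ t be integers, and let U : ℤ → ℝ. Then ∇_a^{−ν}(∇_a^{−υ}U)(t) = ∇_a^{−(ν+υ)}U(t); explicitly, Σ_{s=a}^{t} [Γ(t−s+ν)/(Γ(t−s+1)Γ(ν))] · ( Σ_{u=a}^{s} [Γ(s−u+υ)/(Γ(s−u+1)Γ(υ))] U(u) ) = Σ_{s=a}^{t} [Γ(t−s+ν+υ)/(Γ(t−s+1)Γ(ν+υ))] U(s). -/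
open Finset

/-- The nabla fractional sum kernel is a binomial coefficient of multichoose type. -/
theorem gamma_div_eq_multichoose {ν : ℝ} (hν : 0 < ν) (n : ℕ) :
    Real.Gamma (n + ν) / (Real.Gamma (n + 1) * Real.Gamma ν) = Ring.multichoose ν n := by
  have key : Real.Gamma (n + ν) = (ascPochhammer ℝ n).eval ν * Real.Gamma ν := by
    induction n with
    | zero => simp
    | succ n ih =>
      have h : ((n + 1 : ℕ) : ℝ) + ν = (n + ν) + 1 := by push_cast; ring
      rw [h, Real.Gamma_add_one (by positivity), ih, ascPochhammer_succ_eval]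
      ring
  have hm := Ring.factorial_nsmul_multichoose_eq_ascPochhammer ν n
  rw [Polynomial.ascPochhammer_smeval_eq_eval, nsmul_eq_mul] at hm
  have hΓ := (Real.Gamma_pos_of_pos hν).ne'
  have hn : (n.factorial : ℝ) ≠ 0 := by positivity
  rw [key, ← hm, Real.Gamma_nat_eq_factorial]
  field_simp

/-- Chu-Vandermonde identity for multichoose coefficients. -/
theorem multichoose_add {R : Type*} [CommRing R] [BinomialRing R] (r s : R) (n : ℕ) :
    Ring.multichoose (r + s) n =
      ∑ ij ∈ antidiagonal n, Ring.multichoose r ij.1 * Ring.multichoose s ij.2 := by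
  have hneg (x : R) (k : ℕ) : Ring.multichoose x k = (-1) ^ k * Ring.choose (-x) k := by
    rw [Ring.choose_neg', Units.smul_def, zsmul_eq_mul, ← mul_assoc]
    simp [Int.negOnePow_def, ← mul_pow]
  rw [hneg, neg_add, Ring.add_choose_eq n (Commute.all _ _), mul_sum]
  refine sum_congr rfl fun ij hij => ?_
  rw [hneg, hneg, ← HasAntidiagonal.mem_antidiagonal.mp hij, pow_add]
  ring

/-- Convolution of the kernels of two nabla fractional sums over an integer interval. -/
theorem sum_Icc_gamma_div_mul_gamma_div {ν υ : ℝ} (hν : 0 < ν) (hυ : 0 < υ) {u t : ℤ}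
    (hut : u ≤ t) :
    ∑ s ∈ Icc u t,
      (Real.Gamma (((t - s : ℤ) : ℝ) + ν) / (Real.Gamma (((t - s : ℤ) : ℝ) + 1) * Real.Gamma ν)) *
        (Real.Gamma (((s - u : ℤ) : ℝ) + υ) /
          (Real.Gamma (((s - u : ℤ) : ℝ) + 1) * Real.Gamma υ)) =
      Real.Gamma (((t - u : ℤ) : ℝ) + (ν + υ)) /
        (Real.Gamma (((t - u : ℤ) : ℝ) + 1) * Real.Gamma (ν + υ)) := by
  obtain ⟨n, rfl⟩ := Int.le.dest hut
  rw [show ((u + n - u : ℤ) : ℝ) = n by push_cast; ring,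
    gamma_div_eq_multichoose (add_pos hν hυ), multichoose_add]
  symm
  refine sum_bij (fun ij _ => u + (ij.2 : ℤ)) ?_ ?_ ?_ ?_
  · intro ij hij
    rw [HasAntidiagonal.mem_antidiagonal] at hij
    rw [mem_Icc]
    omega
  · rintro ⟨i, j⟩ hij ⟨i', j'⟩ hij' h
    rw [HasAntidiagonal.mem_antidiagonal] at hij hij'
    simp only [Prod.mk.injEq] at *
    omega
  · intro s hs
    rw [mem_Icc] at hs
    exact ⟨((u + n - s).toNat, (s - u).toNat), by rw [HasAntidiagonal.mem_antidiagonal]; omega, by simp; omega⟩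
  · rintro ⟨i, j⟩ hij
    rw [HasAntidiagonal.mem_antidiagonal] at hij
    subst hij
    rw [← gamma_div_eq_multichoose hν, ← gamma_div_eq_multichoose hυ]
    simp

/-- Composition rule for nabla fractional sums:
`∇_a^{-ν} ∇_a^{-υ} U (t) = ∇_a^{-(ν+υ)} U (t)`. -/
theorem nabla_fractional_sum_comp (ν υ : ℝ) (hν : 0 < ν) (hυ : 0 < υ)
    (a t : ℤ) (hat : a ≤ t) (U : ℤ → ℝ) :
    ∑ s ∈ Finset.Icc a t,
      (Real.Gamma (((t - s : ℤ) : ℝ) + ν) / (Real.Gamma (((t - s : ℤ) : ℝ) + 1) * Real.Gamma ν)) *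
        (∑ u ∈ Finset.Icc a s,
          (Real.Gamma (((s - u : ℤ) : ℝ) + υ) /
            (Real.Gamma (((s - u : ℤ) : ℝ) + 1) * Real.Gamma υ)) * U u) =
    ∑ s ∈ Finset.Icc a t,
      (Real.Gamma (((t - s : ℤ) : ℝ) + (ν + υ)) /
        (Real.Gamma (((t - s : ℤ) : ℝ) + 1) * Real.Gamma (ν + υ))) * U s := by
  simp_rw [mul_sum]
  rw [sum_comm' (t' := Icc a t) (s' := fun u => Icc u t)
    (by intro s u; simp only [mem_Icc]; omega)]
  refine sum_congr rfl fun u hu => ?_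
  simp_rw [← mul_assoc]
  rw [← sum_mul, sum_Icc_gamma_div_mul_gamma_div hν hυ (mem_Icc.mp hu).2]
end

section
/- Let ν > 1 be a real number, let a ≤ t be integers, and let U : ℤ → ℝ. Then ∇(∇_a^{−ν}U)(t) = ∇_a^{−(ν−1)}U(t); explicitly, Σ_{s=a}^{t} [Γ(t−s+ν)/(Γ(t−s+1)Γ(ν))] U(s) − Σ_{s=a}^{t−1} [Γ(t−1−s+ν)/(Γ(t−s)Γ(ν))] U(s) = Σ_{s=a}^{t} [Γ(t−s+ν−1)/(Γ(t−s+1)Γ(ν−1))] U(s). -/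
open Finset

/-- The Pascal-type recurrence of the kernel `Γ(x + ν) / (Γ(x + 1) Γ(ν))` of the nabla fractional
sum. At `x = 0` the subtracted term vanishes because `Γ(0) = 0` and division by zero is zero. -/
theorem Real.Gamma_nabla_kernel_sub {ν x : ℝ} (hν : 1 < ν) (hx : 0 ≤ x) :
    Real.Gamma (x + ν) / (Real.Gamma (x + 1) * Real.Gamma ν)
      - Real.Gamma (x + ν - 1) / (Real.Gamma x * Real.Gamma ν)
      = Real.Gamma (x + ν - 1) / (Real.Gamma (x + 1) * Real.Gamma (ν - 1)) := by
  have hν0 : ν - 1 ≠ 0 := by linarith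
  have hΓν : Real.Gamma ν = (ν - 1) * Real.Gamma (ν - 1) := by
    simpa using Real.Gamma_add_one hν0
  have hΓ : Real.Gamma (ν - 1) ≠ 0 := (Real.Gamma_pos_of_pos (by linarith)).ne'
  have hΓxν : Real.Gamma (x + ν) = (x + ν - 1) * Real.Gamma (x + ν - 1) := by
    simpa using Real.Gamma_add_one (s := x + ν - 1) (by linarith)
  rcases hx.eq_or_lt with rfl | hx
  · simp only [zero_add, Real.Gamma_zero, Real.Gamma_one, zero_mul, div_zero, sub_zero, one_mul]
    rw [hΓν, div_self (mul_ne_zero hν0 hΓ), div_self hΓ]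
  · have hΓx : Real.Gamma x ≠ 0 := (Real.Gamma_pos_of_pos hx).ne'
    rw [hΓxν, hΓν, Real.Gamma_add_one hx.ne']
    field_simp
    ring

/-- `∇ (∇_a^{-ν} U)(t) = ∇_a^{-(ν-1)} U (t)` for `ν > 1`. -/
theorem nabla_of_nabla_fractional_sum (ν : ℝ) (hν : 1 < ν)
    (a t : ℤ) (hat : a ≤ t) (U : ℤ → ℝ) :
    (∑ s ∈ Finset.Icc a t,
      (Real.Gamma (((t - s : ℤ) : ℝ) + ν) / (Real.Gamma (((t - s : ℤ) : ℝ) + 1) * Real.Gamma ν)) * U s)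
    - (∑ s ∈ Finset.Icc a (t - 1),
      (Real.Gamma (((t - 1 - s : ℤ) : ℝ) + ν) / (Real.Gamma (((t - s : ℤ) : ℝ)) * Real.Gamma ν)) * U s)
    = ∑ s ∈ Finset.Icc a t,
      (Real.Gamma (((t - s : ℤ) : ℝ) + ν - 1) /
        (Real.Gamma (((t - s : ℤ) : ℝ) + 1) * Real.Gamma (ν - 1))) * U s := by
  have hext : ∑ s ∈ Finset.Icc a (t - 1),
      (Real.Gamma (((t - 1 - s : ℤ) : ℝ) + ν) / (Real.Gamma (((t - s : ℤ) : ℝ)) * Real.Gamma ν)) * U s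
      = ∑ s ∈ Finset.Icc a t,
      (Real.Gamma (((t - 1 - s : ℤ) : ℝ) + ν) /
        (Real.Gamma (((t - s : ℤ) : ℝ)) * Real.Gamma ν)) * U s := by
    refine Finset.sum_subset (Finset.Icc_subset_Icc_right (by lia)) fun s hs hs' => ?_
    obtain rfl : s = t := by
      simp only [Finset.mem_Icc] at hs hs'
      lia
    simp
  rw [hext, ← Finset.sum_sub_distrib]
  refine Finset.sum_congr rfl fun s hs => ?_
  have hx : (0 : ℝ) ≤ ((t - s : ℤ) : ℝ) := by
    exact_mod_cast sub_nonneg.mpr (Finset.mem_Icc.mp hs).2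
  have hshift : ((t - 1 - s : ℤ) : ℝ) + ν = ((t - s : ℤ) : ℝ) + ν - 1 := by
    push_cast
    ring
  rw [← sub_mul, hshift, Real.Gamma_nabla_kernel_sub hν hx]
end

section
/- Let ν > 0 be a real number, let a, t be integers with t ≥ a + 1, and let U : ℤ → ℝ. Then ∇_{a+1}^{−ν}(∇U)(t) = ∇(∇_a^{−ν}U)(t) − [Γ(t−a+ν)/(Γ(t−a+1)Γ(ν))] U(a); explicitly, Σ_{s=a+1}^{t} [Γ(t−s+ν)/(Γ(t−s+1)Γ(ν))] (U(s) − U(s−1)) = Σ_{s=a}^{t} [Γ(t−s+ν)/(Γ(t−s+1)Γ(ν))] U(s) − Σ_{s=a}^{t−1} [Γ(t−1−s+ν)/(Γ(t−s)Γ(ν))] U(s) − [Γ(t−a+ν)/(Γ(t−a+1)Γ(ν))] U(a). -/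
open Finset

/-- `∇_{a+1}^{-ν} (∇ U)(t) = ∇ (∇_a^{-ν} U)(t) - (t-a+1)^{overline (ν-1)}/Γ(ν) · U(a)`. -/
theorem nabla_fractional_sum_of_nabla (ν : ℝ) (hν : 0 < ν)
    (a t : ℤ) (hat : a + 1 ≤ t) (U : ℤ → ℝ) :
    ∑ s ∈ Finset.Icc (a + 1) t,
      (Real.Gamma (((t - s : ℤ) : ℝ) + ν) / (Real.Gamma (((t - s : ℤ) : ℝ) + 1) * Real.Gamma ν)) *
        (U s - U (s - 1))
    = (∑ s ∈ Finset.Icc a t,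
        (Real.Gamma (((t - s : ℤ) : ℝ) + ν) /
          (Real.Gamma (((t - s : ℤ) : ℝ) + 1) * Real.Gamma ν)) * U s)
      - (∑ s ∈ Finset.Icc a (t - 1),
        (Real.Gamma (((t - 1 - s : ℤ) : ℝ) + ν) /
          (Real.Gamma (((t - s : ℤ) : ℝ)) * Real.Gamma ν)) * U s)
      - (Real.Gamma (((t - a : ℤ) : ℝ) + ν) /
          (Real.Gamma (((t - a : ℤ) : ℝ) + 1) * Real.Gamma ν)) * U a := by
  have hsplit : Finset.Icc a t = insert a (Finset.Icc (a + 1) t) := by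
    ext s
    simp only [Finset.mem_insert, Finset.mem_Icc]
    omega
  have hshift : Finset.Icc (a + 1) t = (Finset.Icc a (t - 1)).map (addRightEmbedding 1) := by
    rw [Finset.map_add_right_Icc, sub_add_cancel]
  have hprev : ∑ s ∈ Finset.Icc (a + 1) t,
      (Real.Gamma (((t - s : ℤ) : ℝ) + ν) /
        (Real.Gamma (((t - s : ℤ) : ℝ) + 1) * Real.Gamma ν)) * U (s - 1)
      = ∑ s ∈ Finset.Icc a (t - 1),
        (Real.Gamma (((t - 1 - s : ℤ) : ℝ) + ν) /
          (Real.Gamma (((t - s : ℤ) : ℝ)) * Real.Gamma ν)) * U s := by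
    rw [hshift, Finset.sum_map]
    refine Finset.sum_congr rfl fun s _ => ?_
    have harg : ((t - (s + 1) : ℤ) : ℝ) + 1 = ((t - s : ℤ) : ℝ) := by
      push_cast
      ring
    rw [addRightEmbedding_apply, harg, add_sub_cancel_right, sub_add_eq_sub_sub_swap]
  rw [hsplit, Finset.sum_insert (by simp), ← hprev]
  simp only [mul_sub, Finset.sum_sub_distrib]
  ring
end

section
/- (Power rule) Let ν > 0 and υ > −1 be real numbers and let a ≤ t be integers. Then ∇_a^{−ν} of the function s ↦ (s−a+1)^{overline υ} evaluated at t equals [Γ(υ+1)/Γ(ν+υ+1)] · (t−a+1)^{overline(ν+υ)}; explicitly, Σ_{s=a}^{t} [Γ(t−s+ν)/(Γ(t−s+1)Γ(ν))] · [Γ(s−a+1+υ)/Γ(s−a+1)] = [Γ(υ+1)/Γ(ν+υ+1)] · Γ(t−a+1+ν+υ)/Γ(t−a+1). -/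
open Finset

/-- The Cauchy product of two sequences satisfying the first-order recurrences of
rising factorials divided by factorials with parameters `x` and `y` satisfies the same recurrence
with parameter `x + y`. -/
theorem sum_antidiagonal_succ_of_recurrence {R : Type*} [CommRing R] {x y : R} {f g : ℕ → R}
    (hf : ∀ n : ℕ, ((n : R) + 1) * f (n + 1) = (x + n) * f n)
    (hg : ∀ n : ℕ, ((n : R) + 1) * g (n + 1) = (y + n) * g n) (n : ℕ) :
    ((n : R) + 1) * ∑ p ∈ antidiagonal (n + 1), f p.1 * g p.2 =
      (x + y + n) * ∑ p ∈ antidiagonal n, f p.1 * g p.2 := by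
  have split : ((n : R) + 1) * ∑ p ∈ antidiagonal (n + 1), f p.1 * g p.2 =
      ∑ p ∈ antidiagonal (n + 1), (p.1 : R) * f p.1 * g p.2 +
        ∑ p ∈ antidiagonal (n + 1), f p.1 * ((p.2 : R) * g p.2) := by
    rw [mul_sum, ← sum_add_distrib]
    refine sum_congr rfl fun p hp => ?_
    have h : (p.1 : R) + p.2 = n + 1 := by
      exact_mod_cast congrArg (Nat.cast (R := R)) (HasAntidiagonal.mem_antidiagonal.1 hp)
    rw [← h]
    ring
  rw [split, Finset.Nat.sum_antidiagonal_succ,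
    Finset.Nat.sum_antidiagonal_succ' (f := fun p => f p.1 * ((p.2 : R) * g p.2))]
  simp only [Nat.cast_zero, zero_mul, mul_zero, zero_add, Nat.cast_add, Nat.cast_one,
    hf, hg]
  rw [← sum_add_distrib, mul_sum]
  refine sum_congr rfl fun p hp => ?_
  have h : (p.1 : R) + p.2 = n := by
      exact_mod_cast congrArg (Nat.cast (R := R)) (HasAntidiagonal.mem_antidiagonal.1 hp)
  rw [← h]
  ring

theorem Real.succ_mul_Gamma_div_Gamma {x : ℝ} (hx : 0 < x) (n : ℕ) :
    ((n : ℝ) + 1) * (Real.Gamma (((n + 1 : ℕ) : ℝ) + x) / Real.Gamma (((n + 1 : ℕ) : ℝ) + 1)) =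
      (x + n) * (Real.Gamma (n + x) / Real.Gamma (n + 1)) := by
  have h₁ : Real.Gamma (((n + 1 : ℕ) : ℝ) + x) = (n + x) * Real.Gamma (n + x) := by
    rw [← Real.Gamma_add_one (by positivity)]
    push_cast
    ring_nf
  have h₂ : Real.Gamma (((n + 1 : ℕ) : ℝ) + 1) = (n + 1) * Real.Gamma (n + 1) := by
    rw [← Real.Gamma_add_one (by positivity)]
    push_cast
    rfl
  have h₃ : Real.Gamma ((n : ℝ) + 1) ≠ 0 := (Real.Gamma_pos_of_pos (by positivity)).ne'
  have h₄ : (n : ℝ) + 1 ≠ 0 := by positivity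
  rw [h₁, h₂]
  field_simp
  ring

/-- The Chu–Vandermonde identity for quotients of Gamma values. -/
theorem Real.sum_antidiagonal_Gamma_div_Gamma {x y : ℝ} (hx : 0 < x) (hy : 0 < y) (n : ℕ) :
    ∑ p ∈ antidiagonal n, (Real.Gamma (p.1 + x) / Real.Gamma (p.1 + 1)) *
        (Real.Gamma (p.2 + y) / Real.Gamma (p.2 + 1)) =
      Real.Gamma x * Real.Gamma y / Real.Gamma (x + y) *
        (Real.Gamma (n + (x + y)) / Real.Gamma (n + 1)) := by
  induction n with
  | zero =>
    have h : Real.Gamma (x + y) ≠ 0 := (Real.Gamma_pos_of_pos (by positivity)).ne'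
    simp [h]
  | succ n ih =>
    have h : (n : ℝ) + 1 ≠ 0 := by positivity
    apply mul_left_cancel₀ h
    rw [sum_antidiagonal_succ_of_recurrence
      (f := fun k : ℕ => Real.Gamma (k + x) / Real.Gamma (k + 1))
      (g := fun k : ℕ => Real.Gamma (k + y) / Real.Gamma (k + 1))
      (Real.succ_mul_Gamma_div_Gamma hx) (Real.succ_mul_Gamma_div_Gamma hy), ih, mul_left_comm,
      mul_left_comm ((n : ℝ) + 1), Real.succ_mul_Gamma_div_Gamma (add_pos hx hy)]

/-- Power rule for the nabla fractional sum:
`∇_a^{-ν} (s-a+1)^{overline υ} (t) = Γ(υ+1)/Γ(ν+υ+1) · (t-a+1)^{overline (ν+υ)}`. -/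
theorem nabla_fractional_sum_power_rule (ν υ : ℝ) (hν : 0 < ν) (hυ : -1 < υ)
    (a t : ℤ) (hat : a ≤ t) :
    ∑ s ∈ Finset.Icc a t,
      (Real.Gamma (((t - s : ℤ) : ℝ) + ν) / (Real.Gamma (((t - s : ℤ) : ℝ) + 1) * Real.Gamma ν)) *
        (Real.Gamma (((s - a : ℤ) : ℝ) + 1 + υ) / Real.Gamma (((s - a : ℤ) : ℝ) + 1))
    = (Real.Gamma (υ + 1) / Real.Gamma (ν + υ + 1)) *
        (Real.Gamma (((t - a : ℤ) : ℝ) + 1 + (ν + υ)) / Real.Gamma (((t - a : ℤ) : ℝ) + 1)) := by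
  obtain ⟨n, rfl⟩ : ∃ n : ℕ, t = a + n := ⟨(t - a).toNat, by omega⟩
  have hΓ : Real.Gamma ν ≠ 0 := (Real.Gamma_pos_of_pos hν).ne'
  have key := Real.sum_antidiagonal_Gamma_div_Gamma hν (show 0 < υ + 1 by linarith) n
  have reindex : ∑ s ∈ Finset.Icc a (a + n),
      (Real.Gamma (((a + n - s : ℤ) : ℝ) + ν) /
          (Real.Gamma (((a + n - s : ℤ) : ℝ) + 1) * Real.Gamma ν)) *
        (Real.Gamma (((s - a : ℤ) : ℝ) + 1 + υ) / Real.Gamma (((s - a : ℤ) : ℝ) + 1)) =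
      (∑ p ∈ antidiagonal n, (Real.Gamma (p.1 + ν) / Real.Gamma (p.1 + 1)) *
        (Real.Gamma (p.2 + (υ + 1)) / Real.Gamma (p.2 + 1))) / Real.Gamma ν := by
    rw [sum_div]
    symm
    refine sum_bij (fun p _ => a + (p.2 : ℤ)) ?_ ?_ ?_ ?_
    · intro p hp
      have := HasAntidiagonal.mem_antidiagonal.1 hp
      rw [Finset.mem_Icc]
      omega
    · rintro ⟨i, j⟩ hp ⟨k, l⟩ hq h
      simp only [HasAntidiagonal.mem_antidiagonal] at hp hq h
      ext <;> simp only <;> omega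
    · intro s hs
      rw [Finset.mem_Icc] at hs
      exact ⟨((a + n - s).toNat, (s - a).toNat), by rw [HasAntidiagonal.mem_antidiagonal]; omega, by
        simp only; omega⟩
    · intro p hp
      have hp' := HasAntidiagonal.mem_antidiagonal.1 hp
      have h₁ : a + (n : ℤ) - (a + (p.2 : ℤ)) = (p.1 : ℤ) := by omega
      have h₂ : a + (p.2 : ℤ) - a = (p.2 : ℤ) := by omega
      rw [h₁, h₂, Int.cast_natCast, Int.cast_natCast, add_assoc, add_comm 1 υ]
      field_simp
  have hn : a + (n : ℤ) - a = n := by omega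
  rw [reindex, key, hn, Int.cast_natCast, ← add_assoc ν υ 1,
    show (n : ℝ) + 1 + (ν + υ) = n + (ν + υ + 1) by ring]
  field_simp
end

section
/- Let η, τ, β be real numbers and n ∈ ℕ. Suppose Y : ℝ → ℝ is (n+2)-times differentiable on (0,∞) and satisfies rY''(r) + (2ηr + 1 + τ)Y'(r) + (η(1+τ) + β)Y(r) = 0 for all r > 0. Then the n-th derivative Y^{(n)} satisfies r Y^{(n+2)}(r) + (2ηr + 1 + τ + n)Y^{(n+1)}(r) + (η(1+τ) + β + 2ηn)Y^{(n)}(r) = 0 for all r > 0. -/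
/-- Integer-order instance of equation (G): applying `d^n/dr^n` to
`rY'' + (2ηr + 1 + τ)Y' + (η(1+τ)+β)Y = 0` gives
`rY^{(n+2)} + (2ηr + 1 + τ + n)Y^{(n+1)} + (η(1+τ)+β+2ηn)Y^{(n)} = 0` on `(0,∞)`. -/
theorem schrodinger_nth_derivative (η τ β : ℝ) (n : ℕ) (Y : ℝ → ℝ)
    (hY : ∀ k ≤ n + 1, ∀ r > 0, DifferentiableAt ℝ (iteratedDeriv k Y) r)
    (hode : ∀ r > 0,
      r * iteratedDeriv 2 Y r + (2 * η * r + 1 + τ) * deriv Y r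
        + (η * (1 + τ) + β) * Y r = 0) :
    ∀ r > 0,
      r * iteratedDeriv (n + 2) Y r
        + (2 * η * r + 1 + τ + n) * iteratedDeriv (n + 1) Y r
        + (η * (1 + τ) + β + 2 * η * n) * iteratedDeriv n Y r = 0 := by
  induction n with
  | zero =>
    intro r hr
    simpa [iteratedDeriv_one] using hode r hr
  | succ n ih =>
    intro r hr
    have ode := ih fun k hk => hY k (by lia)
    have hD (k : ℕ) (hk : k ≤ n + 2) :
        HasDerivAt (iteratedDeriv k Y) (iteratedDeriv (k + 1) Y r) r := by
      rw [iteratedDeriv_succ]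
      exact (hY k hk r hr).hasDerivAt
    have hcoeff : HasDerivAt (fun x : ℝ => 2 * η * x + 1 + τ + n) (2 * η) r := by
      simpa using ((((hasDerivAt_id r).const_mul (2 * η)).add_const 1).add_const τ).add_const (n : ℝ)
    have hsum := (((hasDerivAt_id' r).fun_mul (hD (n + 2) le_rfl)).fun_add
      (hcoeff.fun_mul (hD (n + 1) (by lia)))).fun_add
      ((hD n (by lia)).const_mul (η * (1 + τ) + β + 2 * η * n))
    have hzero : HasDerivAt (fun x => x * iteratedDeriv (n + 2) Y x
        + (2 * η * x + 1 + τ + n) * iteratedDeriv (n + 1) Y x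
        + (η * (1 + τ) + β + 2 * η * n) * iteratedDeriv n Y x) 0 r :=
      (hasDerivAt_const r (0 : ℝ)).congr_of_eventuallyEq <| by
        filter_upwards [lt_mem_nhds hr] with x hx using ode x hx
    have heq := hsum.unique hzero
    rw [show n + 1 + 2 = n + 2 + 1 by lia]
    push_cast
    linear_combination heq
end

section
/- Define g : ℝ → ℝ by g(r) = Σ_{k=0}^{∞} [(11/5)_k / (4)_k] (−10r)^k / k!, where (x)_k = x(x+1)⋯(x+k−1) is the rising (Pochhammer) factorial, i.e., g is the confluent hypergeometric function ₁F₁(11/5; 4; −10r). Then R(r) = e^{5r} r² g(r) satisfies r²R''(r) − (25r² − 2r + 2)R(r) = 0 for all r > 0. (This series converges for every real r.) -/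
open Filter Topology

lemma nat_mul_pow_pred_le {y : ℝ} (hy : 0 ≤ y) (n : ℕ) : n * y ^ (n - 1) ≤ (y + 1) ^ n := by
  cases n with
  | zero => simp
  | succ n =>
    induction n with
    | zero => simpa using hy
    | succ n ih =>
      have h : y ^ (n + 1) ≤ (y + 1) ^ (n + 1) := by gcongr; linarith
      simp only [Nat.add_sub_cancel] at ih ⊢
      have h' := mul_le_mul_of_nonneg_left ih hy
      push_cast at h' ⊢
      rw [pow_succ (y + 1) (n + 1)]
      have e : y * ((n + 1) * y ^ n) = (n + 1) * y ^ (n + 1) := by ring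
      linarith

lemma summable_nat_mul_pow_pred {c : ℕ → ℝ} (hc : ∀ x : ℝ, Summable fun k => c k * x ^ k)
    (x : ℝ) : Summable fun k : ℕ => c k * (k * x ^ (k - 1)) := by
  refine .of_norm_bounded (hc (|x| + 1)).norm fun k => ?_
  simp only [norm_mul, norm_pow, Real.norm_eq_abs, Nat.abs_cast]
  rw [abs_of_nonneg (by positivity : 0 ≤ |x| + 1)]
  gcongr
  exact nat_mul_pow_pred_le (abs_nonneg x) k

lemma summable_succ_mul_pow {c : ℕ → ℝ} (hc : ∀ x : ℝ, Summable fun k => c k * x ^ k) (x : ℝ) :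
    Summable fun k : ℕ => (k + 1) * c (k + 1) * x ^ k := by
  refine ((summable_nat_add_iff 1).2 (summable_nat_mul_pow_pred hc x)).congr fun k => ?_
  push_cast [Nat.add_sub_cancel]
  ring

/-- The sum of an everywhere convergent real power series may be differentiated termwise. -/
lemma hasDerivAt_tsum_mul_pow {c : ℕ → ℝ} (hc : ∀ x : ℝ, Summable fun k => c k * x ^ k) (x : ℝ) :
    HasDerivAt (fun y => ∑' k, c k * y ^ k) (∑' k : ℕ, (k + 1) * c (k + 1) * x ^ k) x := by
  have hx : x ∈ Metric.ball (0 : ℝ) (|x| + 1) := by simp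
  have h : HasDerivAt (fun y => ∑' k, c k * y ^ k) (∑' k : ℕ, c k * (k * x ^ (k - 1))) x := by
    refine hasDerivAt_tsum_of_isPreconnected (hc (|x| + 1 + 1)).norm Metric.isOpen_ball
      (convex_ball 0 _).isPreconnected (fun k y _ => (hasDerivAt_pow k y).const_mul (c k))
      (fun k y hy => ?_) hx (hc x) hx
    have hy' : |y| ≤ |x| + 1 := by simpa using (Metric.mem_ball.1 hy).le
    simp only [norm_mul, norm_pow, Real.norm_eq_abs, Nat.abs_cast]
    rw [abs_of_nonneg (by positivity : 0 ≤ |x| + 1 + 1)]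
    gcongr
    exact (nat_mul_pow_pred_le (abs_nonneg y) k).trans (by gcongr)
  rw [(summable_nat_mul_pow_pred hc x).tsum_eq_zero_add] at h
  convert h using 1
  simp only [Nat.cast_zero, zero_mul, mul_zero, zero_add, Nat.add_sub_cancel]
  refine tsum_congr fun k => ?_
  push_cast
  ring

/-- The coefficients of the confluent hypergeometric series `₁F₁(a; b; z)`. -/
noncomputable def kummerCoeff (a b : ℝ) (k : ℕ) : ℝ :=
  (ascPochhammer ℝ k).eval a / (ascPochhammer ℝ k).eval b / (Nat.factorial k : ℝ)

lemma kummerCoeff_succ (a b : ℝ) (k : ℕ) :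
    kummerCoeff a b (k + 1) = kummerCoeff a b k * ((a + k) / (b + k) / (k + 1)) := by
  simp only [kummerCoeff, ascPochhammer_succ_eval, Nat.factorial_succ]
  push_cast
  simp only [div_eq_mul_inv, mul_inv]
  ring

lemma summable_kummerCoeff_mul_pow (a b x : ℝ) : Summable fun k => kummerCoeff a b k * x ^ k := by
  have h : Tendsto (fun k : ℕ => (a + k) / (b + k) * (x / (k + 1))) atTop (𝓝 0) := by
    have h₁ := tendsto_add_mul_div_add_mul_atTop_nhds a b (1 : ℝ) one_ne_zero
    have h₂ := (tendsto_one_div_add_atTop_nhds_zero_nat (𝕜 := ℝ)).const_mul x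
    simpa [div_eq_mul_inv] using h₁.mul h₂
  refine summable_of_ratio_norm_eventually_le (r := 1 / 2) (by norm_num) ?_
  filter_upwards [h.norm.eventually_le_const (by simp : ‖(0 : ℝ)‖ < 1 / 2)] with k hk
  have e : kummerCoeff a b (k + 1) * x ^ (k + 1) =
      (a + k) / (b + k) * (x / (k + 1)) * (kummerCoeff a b k * x ^ k) := by
    rw [kummerCoeff_succ, pow_succ]
    ring
  rw [e, norm_mul]
  gcongr

/-- Kummer's confluent hypergeometric function `₁F₁(a; b; z)`. -/
noncomputable def kummer (a b z : ℝ) : ℝ := ∑' k, kummerCoeff a b k * z ^ k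

/-- `₁F₁(a; b; ·)` is twice differentiable and solves Kummer's equation `zM'' + (b - z)M' = aM`. -/
lemma exists_hasDerivAt_kummer {a b : ℝ} (hb : ∀ k : ℕ, b + k ≠ 0) :
    ∃ M' M'' : ℝ → ℝ, (∀ z, HasDerivAt (kummer a b) (M' z) z) ∧ (∀ z, HasDerivAt M' (M'' z) z) ∧
      ∀ z, z * M'' z + (b - z) * M' z = a * kummer a b z := by
  set c := kummerCoeff a b
  have hc : ∀ z, Summable fun k => c k * z ^ k := summable_kummerCoeff_mul_pow a b
  have hc' : ∀ z : ℝ, Summable fun k : ℕ => (k + 1) * c (k + 1) * z ^ k := summable_succ_mul_pow hc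
  have hc'' := summable_succ_mul_pow hc'
  refine ⟨_, _, hasDerivAt_tsum_mul_pow hc, hasDerivAt_tsum_mul_pow hc', fun z => ?_⟩
  have shift {d : ℕ → ℝ} {s : ℝ} (hd : HasSum (fun k : ℕ => (k + 1) * d (k + 1) * z ^ k) s) :
      HasSum (fun k : ℕ => k * d k * z ^ k) (z * s) := by
    rw [← hasSum_nat_add_iff' 1, Finset.sum_range_one, Nat.cast_zero, zero_mul, zero_mul, sub_zero]
    refine (hd.mul_left z).congr_fun fun k => ?_
    push_cast
    ring
  have h₀ := (hc z).hasSum.mul_left a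
  have h₁ := (hc' z).hasSum
  have h₂ := shift (d := fun k : ℕ => (k + 1) * c (k + 1)) (hc'' z).hasSum
  refine HasSum.unique ?_ h₀
  rw [sub_mul]
  refine (h₂.add ((h₁.mul_left b).sub (shift h₁))).congr_fun fun k => ?_
  have e : (b + k) * ((k + 1) * c (k + 1)) = (a + k) * c k := by
    have := hb k
    have : (k + 1 : ℝ) ≠ 0 := by positivity
    simp only [c, kummerCoeff_succ]
    field_simp
  linear_combination -z ^ k * e

lemma kummer_summand_eq (a b z : ℝ) (k : ℕ) :
    (ascPochhammer ℝ k).eval a / (ascPochhammer ℝ k).eval b * z ^ k / (Nat.factorial k : ℝ) =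
      kummerCoeff a b k * z ^ k := by
  rw [kummerCoeff]
  ring


/-- With `g = ₁F₁(11/5; 4; -10r)` (which converges for every real `r`),
`R(r) = e^{5r} r² g(r)` solves `r²R'' - (25r² - 2r + 2)R = 0` on `(0,∞)`. -/
theorem example_one_solution_one :
    (∀ r : ℝ, Summable (fun k : ℕ =>
      ((ascPochhammer ℝ k).eval (11 / 5) / (ascPochhammer ℝ k).eval 4) * (-10 * r) ^ k /
        (Nat.factorial k : ℝ))) ∧
    (∀ r : ℝ, 0 < r →
      r ^ 2 * deriv (deriv (fun x : ℝ => Real.exp (5 * x) * x ^ 2 *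
          ∑' k : ℕ, ((ascPochhammer ℝ k).eval (11 / 5) / (ascPochhammer ℝ k).eval 4) *
            (-10 * x) ^ k / (Nat.factorial k : ℝ))) r
        - (25 * r ^ 2 - 2 * r + 2) * (Real.exp (5 * r) * r ^ 2 *
          ∑' k : ℕ, ((ascPochhammer ℝ k).eval (11 / 5) / (ascPochhammer ℝ k).eval 4) *
            (-10 * r) ^ k / (Nat.factorial k : ℝ)) = 0) := by
  simp only [kummer_summand_eq]
  refine ⟨fun r => summable_kummerCoeff_mul_pow _ _ _, fun r hr => ?_⟩
  change r ^ 2 * deriv (deriv fun x : ℝ =>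
    Real.exp (5 * x) * x ^ 2 * kummer (11 / 5) 4 (-10 * x)) r - (25 * r ^ 2 - 2 * r + 2) *
      (Real.exp (5 * r) * r ^ 2 * kummer (11 / 5) 4 (-10 * r)) = 0
  obtain ⟨M', M'', h₁, h₂, hode⟩ :=
    exists_hasDerivAt_kummer (a := 11 / 5) (b := 4) fun k => by positivity
  set M := kummer (11 / 5) 4
  have hexp (x : ℝ) : HasDerivAt (fun x : ℝ => Real.exp (5 * x)) (5 * Real.exp (5 * x)) x := by
    simpa [mul_comm] using ((hasDerivAt_id x).const_mul 5).exp
  have hlin (x : ℝ) : HasDerivAt (fun x : ℝ => -10 * x) (-10) x := by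
    simpa using (hasDerivAt_id x).const_mul (-10)
  have hsq (x : ℝ) : HasDerivAt (fun x : ℝ => x ^ 2) (2 * x) x := by simpa using hasDerivAt_pow 2 x
  have hM (x : ℝ) := (h₁ (-10 * x)).comp x (hlin x)
  have hM' (x : ℝ) := (h₂ (-10 * x)).comp x (hlin x)
  have hR (x : ℝ) : HasDerivAt (fun x => Real.exp (5 * x) * x ^ 2 * M (-10 * x))
      (Real.exp (5 * x) * ((5 * x ^ 2 + 2 * x) * M (-10 * x) - 10 * x ^ 2 * M' (-10 * x))) x := by
    refine (((hexp x).mul (hsq x)).mul (hM x)).congr_deriv ?_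
    simp only [Function.comp_apply, Pi.mul_apply]
    ring
  have hR' := (hexp r).mul (((((hsq r).const_mul 5).add ((hasDerivAt_id r).const_mul 2)).mul
    (hM r)).sub (((hsq r).const_mul 10).mul (hM' r)))
  rw [funext fun x => (hR x).deriv]
  have hd := hR'.deriv
  simp only [Function.comp_def, id, Pi.mul_def, Pi.add_def, Pi.sub_def] at hd
  rw [hd]
  linear_combination (-10 * r ^ 3 * Real.exp (5 * r)) * hode (-10 * r)
end

section
/- Let B be a real constant. Then the function R(r) = B e^{r}(1 − 2r + 2r²)/r satisfies the radial equation r²R''(r) − (r² + 2r + 2)R(r) = 0 for all r ≠ 0. -/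
theorem hasDerivAt_const_mul_exp_mul_div (B : ℝ) {p : ℝ → ℝ} {p' x : ℝ}
    (hp : HasDerivAt p p' x) (n : ℕ) (hx : x ≠ 0) :
    HasDerivAt (fun y : ℝ => B * Real.exp y * p y / y ^ n)
      (((B * Real.exp x * p x + B * Real.exp x * p') * x ^ n
        - B * Real.exp x * p x * (n * x ^ (n - 1))) / (x ^ n) ^ 2) x :=
  (((Real.hasDerivAt_exp x).const_mul B).mul hp).div (hasDerivAt_pow n x) (pow_ne_zero n hx)

/-- `R(r) = B e^{r}(1 - 2r + 2r²)/r` solves `r²R'' - (r² + 2r + 2)R = 0` for all `r ≠ 0`. -/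
theorem example_two_solution_two (B : ℝ) :
    ∀ r : ℝ, r ≠ 0 →
      r ^ 2 * deriv (deriv (fun x : ℝ => B * Real.exp x * (1 - 2 * x + 2 * x ^ 2) / x)) r
        - (r ^ 2 + 2 * r + 2) * (B * Real.exp r * (1 - 2 * r + 2 * r ^ 2) / r) = 0 := by
  intro r hr
  have hp (x : ℝ) : HasDerivAt (fun y : ℝ => 1 - 2 * y + 2 * y ^ 2) (-2 + 4 * x) x := by
    refine ((((hasDerivAt_id' x).const_mul 2).const_sub 1).add
      ((hasDerivAt_pow 2 x).const_mul 2)).congr_deriv ?_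
    push_cast
    ring
  have hq (x : ℝ) : HasDerivAt (fun y : ℝ => 2 * y ^ 3 + y - 1) (6 * x ^ 2 + 1) x := by
    refine ((((hasDerivAt_pow 3 x).const_mul 2).add (hasDerivAt_id' x)).sub_const 1).congr_deriv ?_
    push_cast
    ring
  have h_first : deriv (fun x : ℝ => B * Real.exp x * (1 - 2 * x + 2 * x ^ 2) / x) =ᶠ[nhds r]
      fun x => B * Real.exp x * (2 * x ^ 3 + x - 1) / x ^ 2 := by
    filter_upwards [isOpen_ne.mem_nhds hr] with x hx
    have h := (hasDerivAt_const_mul_exp_mul_div B (hp x) 1 hx).deriv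
    simp only [pow_one] at h
    rw [h]
    push_cast
    ring
  rw [h_first.deriv_eq, (hasDerivAt_const_mul_exp_mul_div B (hq r) 2 hr).deriv]
  push_cast
  field_simp
  ring
end

section
/- Let α, β, γ, δ be real numbers with α > 0 and 1 + 4(γ+δ) ≥ 0; set τ = √(1 + 4(γ+δ)). Suppose Y : ℝ → ℝ is twice differentiable on (0,∞) and satisfies rY''(r) + (2αr + 1 + τ)Y'(r) + (α(1+τ) + β)Y(r) = 0 for all r > 0. Then R(r) = r^{(1+τ)/2} e^{αr} Y(r) satisfies r²R''(r) − (α²r² − βr + (γ+δ))R(r) = 0 for all r > 0. -/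
/-- The derivative of `x ^ p * exp (a * x)` on the positive half-line, written as the function times
its logarithmic derivative. -/
theorem hasDerivAt_rpow_mul_exp (p a : ℝ) {r : ℝ} (hr : 0 < r) :
    HasDerivAt (fun x : ℝ => x ^ p * Real.exp (a * x))
      (r ^ p * Real.exp (a * r) * (p / r + a)) r := by
  have hexp : HasDerivAt (fun x : ℝ => Real.exp (a * x)) (Real.exp (a * r) * a) r := by
    simpa using ((hasDerivAt_id' r).const_mul a).exp
  refine ((Real.hasDerivAt_rpow_const (p := p) (Or.inl hr.ne')).fun_mul hexp).congr_deriv ?_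
  rw [Real.rpow_sub_one hr.ne']
  ring

/-- (Theorem 3.3, case ρ = -2.) If `Y` solves the transformed equation
`rY'' + (2αr + 1 + τ)Y' + (α(1+τ)+β)Y = 0` with `τ = √(1+4(γ+δ))`,
then `R(r) = r^{(1+τ)/2} e^{αr} Y(r)` solves
`r²R'' - (α²r² - βr + (γ+δ))R = 0` on `(0,∞)`. -/
theorem schrodinger_solution_rho_neg_two (α β γ δ : ℝ)
    (hα : 0 < α) (hγδ : 1 + 4 * (γ + δ) ≥ 0)
    (Y : ℝ → ℝ)
    (hY1 : ∀ r > 0, DifferentiableAt ℝ Y r)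
    (hY2 : ∀ r > 0, DifferentiableAt ℝ (deriv Y) r)
    (hode : ∀ r > 0,
      r * deriv (deriv Y) r
        + (2 * α * r + 1 + Real.sqrt (1 + 4 * (γ + δ))) * deriv Y r
        + (α * (1 + Real.sqrt (1 + 4 * (γ + δ))) + β) * Y r = 0)
    (R : ℝ → ℝ)
    (hR : ∀ r > 0, R r = r ^ ((1 + Real.sqrt (1 + 4 * (γ + δ))) / 2) *
      Real.exp (α * r) * Y r) :
    ∀ r > 0, r ^ 2 * deriv (deriv R) r
      - (α ^ 2 * r ^ 2 - β * r + (γ + δ)) * R r = 0 := by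
  set τ := Real.sqrt (1 + 4 * (γ + δ)) with hτ
  have hτ_sq : τ ^ 2 = 1 + 4 * (γ + δ) := Real.sq_sqrt hγδ
  have hR' : ∀ r > 0, deriv R r = r ^ ((1 + τ) / 2) * Real.exp (α * r) *
      (((1 + τ) / 2 / r + α) * Y r + deriv Y r) := by
    intro r hr
    have hRY : R =ᶠ[nhds r] fun x => x ^ ((1 + τ) / 2) * Real.exp (α * x) * Y x := by
      filter_upwards [lt_mem_nhds hr] with x hx using hR x hx
    rw [hRY.deriv_eq,
      ((hasDerivAt_rpow_mul_exp ((1 + τ) / 2) α hr).fun_mul (hY1 r hr).hasDerivAt).deriv]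
    ring
  intro r hr
  have hRY : deriv R =ᶠ[nhds r] fun x => x ^ ((1 + τ) / 2) * Real.exp (α * x) *
      (((1 + τ) / 2 / x + α) * Y x + deriv Y x) := by
    filter_upwards [lt_mem_nhds hr] with x hx using hR' x hx
  have hlog : HasDerivAt (fun x : ℝ => (1 + τ) / 2 / x + α) (-((1 + τ) / 2) / r ^ 2) r := by
    simpa using ((hasDerivAt_const r ((1 + τ) / 2)).fun_div (hasDerivAt_id' r) hr.ne').add_const α
  have hinner := (hlog.fun_mul (hY1 r hr).hasDerivAt).fun_add (hY2 r hr).hasDerivAt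
  rw [hRY.deriv_eq, ((hasDerivAt_rpow_mul_exp ((1 + τ) / 2) α hr).fun_mul hinner).deriv, hR r hr]
  have hode_r := hode r hr
  generalize r ^ ((1 + τ) / 2) * Real.exp (α * r) = g
  have hr0 : r ≠ 0 := hr.ne'
  field_simp
  linear_combination 4 * g * r * hode_r + g * Y r * hτ_sq
end
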